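/- Let E be a nonzero finite-dimensional complex normed vector space, let u : Δ → E be holomorphic on the open unit disc Δ with bounded image, and let ν, ν′ ∈ (−π/2, π/2). Then for almost every θ ∈ [0, 2π], both limits u*_ν(e^{iθ}) := lim_{t→0⁺} u(e^{iθ} − t e^{i(θ−ν)}) and u*_{ν′}(e^{iθ}) := lim_{t→0⁺} u(e^{iθ} − t e^{i(θ−ν′)}) exist and are equal. -/

import Mathlib

open MeasureTheory Filter Set Metric

/-- The maximum principle on the unit disc with one exceptional boundary point `ζ₀`, near which the
function is only assumed to be bounded. -/
theorem norm_le_of_norm_le_on_sphere_diff_singleton {J : ℂ → ℂ} {ζ₀ : ℂ} {K ε : ℝ}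
    (hζ₀ : ‖ζ₀‖ = 1) (hε : 0 < ε) (hd : DifferentiableOn ℂ J (ball 0 1))
    (hc : ContinuousOn J (closedBall 0 1 \ {ζ₀}))
    (hK : ∀ z ∈ closedBall (0 : ℂ) 1 \ {ζ₀}, ‖J z‖ ≤ K)
    (hJ : ∀ z ∈ sphere (0 : ℂ) 1 \ {ζ₀}, ‖J z‖ ≤ ε) {z : ℂ} (hz : z ∈ ball (0 : ℂ) 1) :
    ‖J z‖ ≤ ε := by
  have hne : z ≠ ζ₀ := by
    rintro rfl
    simp [hζ₀] at hz
  have key (n : ℕ) : ‖J z‖ ^ n * ‖z - ζ₀‖ ≤ ε ^ n * 2 := by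
    have hcont : ContinuousOn (fun w ↦ J w ^ n * (w - ζ₀)) (closedBall 0 1) := by
      intro w hw
      by_cases hwζ : w = ζ₀
      · subst hwζ
        have hlim : Tendsto (fun v ↦ max K ‖J w‖ ^ n * ‖v - w‖)
            (nhdsWithin w (closedBall 0 1)) (nhds 0) := by
          have : Continuous fun v ↦ max K ‖J w‖ ^ n * ‖v - w‖ := by fun_prop
          simpa using (this.tendsto w).mono_left nhdsWithin_le_nhds
        rw [ContinuousWithinAt, sub_self, mul_zero]
        refine squeeze_zero_norm' ?_ hlim
        filter_upwards [self_mem_nhdsWithin] with v hv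
        rw [norm_mul, norm_pow]
        gcongr
        by_cases hvw : v = w
        · rw [hvw]; exact le_max_right _ _
        · exact (hK v ⟨hv, hvw⟩).trans (le_max_left _ _)
      · have h1 : ContinuousWithinAt J (closedBall 0 1) w :=
          (hc w ⟨hw, hwζ⟩).mono_of_mem_nhdsWithin
            (sdiff_mem self_mem_nhdsWithin
              (mem_nhdsWithin_of_mem_nhds (isOpen_ne.mem_nhds hwζ)))
        fun_prop
    have hdc : DiffContOnCl ℂ (fun w ↦ J w ^ n * (w - ζ₀)) (ball 0 1) :=
      ⟨(hd.pow n).mul (by fun_prop), by rwa [closure_ball _ one_ne_zero]⟩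
    have := Complex.norm_le_of_forall_mem_frontier_norm_le (C := ε ^ n * 2) isBounded_ball hdc
      (fun w hw ↦ ?_) (subset_closure hz)
    · simpa using this
    · rw [frontier_ball _ one_ne_zero] at hw
      rw [norm_mul, norm_pow]
      by_cases hwζ : w = ζ₀
      · simp only [hwζ, sub_self, norm_zero, mul_zero]
        positivity
      · have : ‖w - ζ₀‖ ≤ 2 := by
          calc ‖w - ζ₀‖ ≤ ‖w‖ + ‖ζ₀‖ := norm_sub_le _ _
            _ = 2 := by rw [mem_sphere_zero_iff_norm.1 hw, hζ₀]; norm_num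
        gcongr
        exact hJ w ⟨hw, hwζ⟩
  by_contra! hlt
  have hpos : 0 < ‖z - ζ₀‖ := norm_pos_iff.2 (sub_ne_zero.2 hne)
  obtain ⟨n, hn⟩ := pow_unbounded_of_one_lt (2 / ‖z - ζ₀‖) ((one_lt_div hε).2 hlt)
  rw [div_pow, div_lt_div_iff₀ hpos (by positivity)] at hn
  linarith [key n]

/-- A bounded holomorphic function on the unit disc whose boundary values tend to `0` at a boundary
point `ζ₀` tends to `0` at `ζ₀` from within the disc. -/
theorem tendsto_zero_within_ball_of_tendsto_zero_within_sphere {H : ℂ → ℂ} {ζ₀ : ℂ} {M : ℝ}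
    (hζ₀ : ‖ζ₀‖ = 1) (hd : DifferentiableOn ℂ H (ball 0 1))
    (hc : ContinuousOn H (closedBall 0 1 \ {ζ₀}))
    (hM : ∀ z ∈ closedBall (0 : ℂ) 1 \ {ζ₀}, ‖H z‖ ≤ M)
    (hH : Tendsto H (nhdsWithin ζ₀ (sphere 0 1 \ {ζ₀})) (nhds 0)) :
    Tendsto H (nhdsWithin ζ₀ (ball 0 1)) (nhds 0) := by
  rw [Metric.tendsto_nhds]
  intro ε hε
  have hM0 : 0 ≤ M := (norm_nonneg _).trans (hM 0 ⟨by simp, by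
    rintro h
    rw [mem_singleton_iff] at h
    simp [← h] at hζ₀⟩)
  obtain ⟨r, hr, hrε⟩ := Metric.tendsto_nhdsWithin_nhds.1 hH (ε / 2) (half_pos hε)
  set C : ℝ := 2 / r ^ 2 * (2 * M / ε) with hC
  have hC0 : 0 ≤ C := by positivity
  set q : ℂ → ℂ := fun z ↦ C * (1 - z * (starRingEnd ℂ) ζ₀) with hq
  have hqre (z : ℂ) (hz : ‖z‖ ≤ 1) : 0 ≤ (q z).re := by
    have h1 : (z * (starRingEnd ℂ) ζ₀).re ≤ 1 := by
      refine (Complex.re_le_norm _).trans ?_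
      simpa [hζ₀] using hz
    simp only [hq, Complex.re_ofReal_mul, Complex.sub_re, Complex.one_re]
    exact mul_nonneg hC0 (sub_nonneg.2 h1)
  have hqsphere (z : ℂ) (hz : ‖z‖ = 1) : (q z).re = C * (‖z - ζ₀‖ ^ 2 / 2) := by
    have h1 : ‖z - ζ₀‖ ^ 2 = 2 - 2 * (z * (starRingEnd ℂ) ζ₀).re := by
      rw [Complex.sq_norm, Complex.normSq_sub, ← Complex.sq_norm, ← Complex.sq_norm, hz, hζ₀]
      norm_num
    simp only [hq, Complex.re_ofReal_mul, Complex.sub_re, Complex.one_re]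
    rw [h1]; ring
  have hexp_le (z : ℂ) (hz : ‖z‖ ≤ 1) : ‖Complex.exp (-q z)‖ ≤ 1 := by
    rw [Complex.norm_exp, Complex.neg_re]
    exact Real.exp_le_one_iff.2 (neg_nonpos.2 (hqre z hz))
  have hqd : Differentiable ℂ q := by fun_prop
  have hJ (z : ℂ) (hz : z ∈ ball (0 : ℂ) 1) : ‖H z * Complex.exp (-q z)‖ ≤ ε / 2 := by
    refine norm_le_of_norm_le_on_sphere_diff_singleton
      (J := fun z ↦ H z * Complex.exp (-q z)) (K := M) hζ₀ (half_pos hε)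
      (hd.mul (by fun_prop)) (hc.mul (by fun_prop)) (fun w hw ↦ ?_) (fun w hw ↦ ?_) hz
    · rw [norm_mul]
      exact (mul_le_of_le_one_right (norm_nonneg _)
        (hexp_le w (mem_closedBall_zero_iff.1 hw.1))).trans (hM w hw)
    · have hw1 := mem_sphere_zero_iff_norm.1 hw.1
      rw [norm_mul]
      by_cases hwr : dist w ζ₀ < r
      · have := hrε hw hwr
        rw [dist_zero_right] at this
        exact (mul_le_of_le_one_right (norm_nonneg _) (hexp_le w hw1.le)).trans this.le
      · rw [not_lt, dist_eq_norm] at hwr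
        have h1 : 2 * M / ε ≤ (q w).re := by
          rw [hqsphere w hw1, hC]
          calc 2 * M / ε = 2 / r ^ 2 * (2 * M / ε) * (r ^ 2 / 2) := by field_simp
            _ ≤ _ := by gcongr
        have h2 : 2 * M / ε ≤ Real.exp (q w).re :=
          h1.trans ((le_add_of_nonneg_right zero_le_one).trans (Real.add_one_le_exp _))
        have h3 : ‖H w‖ ≤ M := hM w ⟨sphere_subset_closedBall hw.1, hw.2⟩
        rw [Complex.norm_exp, Complex.neg_re, Real.exp_neg, ← div_eq_mul_inv,
          div_le_iff₀ (Real.exp_pos _)]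
        rw [div_le_iff₀ hε] at h2
        linarith
  have hnear : ∀ᶠ z in nhdsWithin ζ₀ (ball 0 1), ‖Complex.exp (q z)‖ < 2 := by
    have hcont : Continuous fun z ↦ ‖Complex.exp (q z)‖ := by
      have := hqd.continuous
      fun_prop
    have hq0 : q ζ₀ = 0 := by simp [hq, Complex.mul_conj, Complex.normSq_eq_norm_sq, hζ₀]
    refine nhdsWithin_le_nhds (hcont.continuousAt.eventually_lt continuousAt_const ?_)
    simp [hq0]
  filter_upwards [hnear, self_mem_nhdsWithin] with z hz2 hz
  rw [dist_zero_right]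
  calc ‖H z‖ = ‖H z * Complex.exp (-q z)‖ * ‖Complex.exp (q z)‖ := by
        rw [← norm_mul, mul_assoc, ← Complex.exp_add]; simp
    _ ≤ ε / 2 * ‖Complex.exp (q z)‖ := by gcongr; exact hJ z hz
    _ < ε / 2 * 2 := by gcongr
    _ = ε := by ring

/-- If `θ ↦ g (e^{iθ})` is differentiable at `θ₀`, then `g` has a first order complex expansion at
`e^{iθ₀}` along the unit circle. -/
theorem exists_isLittleO_within_sphere_of_differentiableAt {g : ℂ → ℂ} {θ₀ : ℝ}
    (hg : DifferentiableAt ℝ (fun θ : ℝ ↦ g (Complex.exp (θ * Complex.I))) θ₀) :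
    ∃ a : ℂ, (fun ζ ↦ g ζ - g (Complex.exp (θ₀ * Complex.I))
        - a * (ζ - Complex.exp (θ₀ * Complex.I)))
      =o[nhdsWithin (Complex.exp (θ₀ * Complex.I)) (sphere 0 1)]
        (fun ζ ↦ ζ - Complex.exp (θ₀ * Complex.I)) := by
  set ζ₀ := Complex.exp (θ₀ * Complex.I) with hζ₀
  have hne : ζ₀ ≠ 0 := Complex.exp_ne_zero _
  set d := deriv (fun θ : ℝ ↦ g (Complex.exp (θ * Complex.I))) θ₀ with hd
  refine ⟨d / (ζ₀ * Complex.I), ?_⟩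
  set a := d / (ζ₀ * Complex.I) with ha
  have hexp : HasDerivAt (fun θ : ℝ ↦ Complex.exp (θ * Complex.I)) (ζ₀ * Complex.I) θ₀ := by
    have h1 : HasDerivAt (fun z : ℂ ↦ Complex.exp (z * Complex.I)) (ζ₀ * Complex.I) (θ₀ : ℂ) := by
      simpa using ((hasDerivAt_id (θ₀ : ℂ)).mul_const Complex.I).cexp
    exact h1.comp_ofReal
  have hW : HasDerivAt (fun θ : ℝ ↦ g (Complex.exp (θ * Complex.I))
      - a * Complex.exp (θ * Complex.I)) 0 θ₀ := by
    have := hg.hasDerivAt.sub (hexp.const_mul a)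
    rwa [← hd, ha, div_mul_cancel₀ _ (mul_ne_zero hne Complex.I_ne_zero), sub_self] at this
  set s : ℂ → ℝ := fun ζ ↦ θ₀ + (ζ / ζ₀).arg with hs
  have hs0 : s ζ₀ = θ₀ := by simp [hs, hne]
  have hsd : DifferentiableAt ℝ s ζ₀ := by
    have h1 : DifferentiableAt ℂ (fun ζ ↦ Complex.log (ζ / ζ₀)) ζ₀ :=
      (differentiableAt_id.div_const ζ₀).clog (by simp [hne])
    have h2 : DifferentiableAt ℝ (fun ζ ↦ (Complex.log (ζ / ζ₀)).im) ζ₀ :=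
      Complex.imCLM.differentiableAt.comp ζ₀ (h1.restrictScalars ℝ)
    simpa only [hs, Complex.log_im] using h2.const_add θ₀
  have hst : Tendsto s (nhds ζ₀) (nhds θ₀) := by
    simpa [hs0] using hsd.continuousAt.tendsto
  have hO : (fun ζ ↦ s ζ - θ₀) =O[nhds ζ₀] fun ζ ↦ ζ - ζ₀ := by
    simpa [hs0] using hsd.isBigO_sub
  have hlo := ((hasDerivAt_iff_isLittleO.1 hW).comp_tendsto hst).trans_isBigO hO
  refine (hlo.mono nhdsWithin_le_nhds).congr' ?_ EventuallyEq.rfl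
  filter_upwards [self_mem_nhdsWithin] with ζ hζ
  have hζs : Complex.exp (s ζ * Complex.I) = ζ := by
    have h1 : ‖ζ / ζ₀‖ = 1 := by
      rw [norm_div, mem_sphere_zero_iff_norm.1 hζ, hζ₀, Complex.norm_exp_ofReal_mul_I, div_one]
    have h2 := Complex.norm_mul_exp_arg_mul_I (ζ / ζ₀)
    rw [h1, Complex.ofReal_one, one_mul] at h2
    simp only [hs, Complex.ofReal_add, add_mul]
    rw [Complex.exp_add, h2, ← hζ₀, mul_div_cancel₀ _ hne]
  simp only [Function.comp_apply, hζs, smul_zero, ← hζ₀]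
  ring

/-- A first order expansion of a holomorphic function at a boundary point of the disc gives the
nontangential limit of its derivative there. -/
theorem tendsto_deriv_nontangential_of_isLittleO {g : ℂ → ℂ} {ζ₀ a b : ℂ} {k : ℝ}
    (hζ₀ : ‖ζ₀‖ = 1) (hk : 0 < k) (hd : DifferentiableOn ℂ g (ball 0 1))
    (hg : (fun z ↦ g z - b - a * (z - ζ₀)) =o[nhdsWithin ζ₀ (ball 0 1)] (fun z ↦ z - ζ₀)) :
    Tendsto (deriv g) (nhdsWithin ζ₀ {z | ‖z‖ < 1 ∧ k * ‖z - ζ₀‖ ≤ 1 - ‖z‖}) (nhds a) := by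
  rw [Metric.tendsto_nhds]
  intro ε hε
  obtain ⟨r, hr, hrb⟩ := Metric.mem_nhdsWithin_iff.1 (hg.def (c := ε * k / 8) (by positivity))
  filter_upwards [self_mem_nhdsWithin, mem_nhdsWithin_of_mem_nhds
    (ball_mem_nhds ζ₀ (half_pos hr))] with z hz hzr
  obtain ⟨hz1, hzk⟩ := hz
  rw [mem_ball_iff_norm] at hzr
  set R := (1 - ‖z‖) / 2 with hR
  have hR0 : 0 < R := by rw [hR]; linarith
  have hRz : 2 * R ≤ ‖z - ζ₀‖ := by
    have := norm_sub_norm_le ζ₀ z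
    rw [hζ₀, norm_sub_rev] at this
    rw [hR]; linarith
  have hsub : closedBall z R ⊆ ball 0 1 := fun w hw ↦ by
    rw [mem_closedBall_iff_norm] at hw
    have := norm_sub_norm_le w z
    rw [mem_ball_zero_iff]
    linarith
  set G : ℂ → ℂ := fun z ↦ g z - b - a * (z - ζ₀)
  have hGd : DifferentiableOn ℂ G (ball 0 1) := (hd.sub_const b).sub (by fun_prop)
  have hderiv : deriv G z = deriv g z - a := by
    have h1 := (hd.differentiableAt (isOpen_ball.mem_nhds (mem_ball_zero_iff.2 hz1))).hasDerivAt
    have h2 := ((hasDerivAt_id z).sub_const ζ₀).const_mul a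
    rw [mul_one] at h2
    exact ((h1.sub_const b).sub h2).deriv
  have hdc : DiffContOnCl ℂ G (ball z R) :=
    DifferentiableOn.diffContOnCl (by
      rw [closure_ball _ hR0.ne']
      exact hGd.mono hsub)
  have hbound : ∀ w ∈ sphere z R, ‖G w‖ ≤ ε * k / 8 * (2 * ‖z - ζ₀‖) := fun w hw ↦ by
    have hwz : ‖w - ζ₀‖ ≤ R + ‖z - ζ₀‖ := by
      have := norm_sub_le_norm_sub_add_norm_sub w z ζ₀
      rwa [mem_sphere_iff_norm.1 hw] at this
    have hwb : w ∈ ball ζ₀ r := by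
      rw [mem_ball_iff_norm]; linarith
    refine (hrb ⟨hwb, hsub (sphere_subset_closedBall hw)⟩ : ‖G w‖ ≤ _).trans ?_
    gcongr
    linarith
  have := Complex.norm_deriv_le_of_forall_mem_sphere_norm_le hR0 hdc hbound
  rw [dist_eq_norm, ← hderiv]
  refine this.trans_lt ?_
  rw [div_lt_iff₀ hR0]
  have h1 : ε * (k * ‖z - ζ₀‖) ≤ ε * (2 * R) :=
    mul_le_mul_of_nonneg_left (by linarith) hε.le
  nlinarith [mul_pos hε hR0]

/-- Fatou's theorem: a bounded holomorphic function on the unit disc has a nontangential limit at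
almost every boundary point. -/
theorem ae_exists_tendsto_nontangential {f : ℂ → ℂ} {M : NNReal}
    (hf : DifferentiableOn ℂ f (ball 0 1)) (hM : ∀ z ∈ ball (0 : ℂ) 1, ‖f z‖₊ ≤ M) :
    ∀ᵐ θ : ℝ, ∃ a : ℂ, ∀ k : ℝ, 0 < k →
      Tendsto f (nhdsWithin (Complex.exp (θ * Complex.I))
        {z | ‖z‖ < 1 ∧ k * ‖z - Complex.exp (θ * Complex.I)‖ ≤ 1 - ‖z‖}) (nhds a) := by
  obtain ⟨F, hF⟩ := hf.isExactOn_ball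
  obtain ⟨g, hgL, hgF⟩ := (Convex.lipschitzOnWith_of_nnnorm_hasDerivWithin_le
    (convex_ball (0 : ℂ) 1) (fun z hz ↦ (hF z hz).hasDerivWithinAt) hM).extend_finite_dimension
  set L := lipschitzExtensionConstant ℂ * M
  have hg' : ∀ z ∈ ball (0 : ℂ) 1, HasDerivAt g (f z) z := fun z hz ↦
    (hF z hz).congr_of_eventuallyEq
      (hgF.symm.eventuallyEq_of_mem (isOpen_ball.mem_nhds hz))
  have hgd : DifferentiableOn ℂ g (ball 0 1) := fun z hz ↦
    (hg' z hz).differentiableAt.differentiableWithinAt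
  have hexpL : LipschitzWith 1 fun θ : ℝ ↦ Complex.exp (θ * Complex.I) := by
    have h1 (θ : ℝ) : HasDerivAt (fun θ : ℝ ↦ Complex.exp (θ * Complex.I))
        (Complex.exp (θ * Complex.I) * Complex.I) θ := by
      have : HasDerivAt (fun z : ℂ ↦ Complex.exp (z * Complex.I))
          (Complex.exp (θ * Complex.I) * Complex.I) (θ : ℂ) := by
        simpa using ((hasDerivAt_id (θ : ℂ)).mul_const Complex.I).cexp
      exact this.comp_ofReal
    refine lipschitzWith_of_nnnorm_deriv_le (fun θ ↦ (h1 θ).differentiableAt) fun θ ↦ ?_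
    rw [(h1 θ).deriv, ← NNReal.coe_le_coe]
    simp
  filter_upwards [(hgL.comp hexpL).ae_differentiableAt_real] with θ hθ
  obtain ⟨a, ha⟩ := exists_isLittleO_within_sphere_of_differentiableAt (g := g) hθ
  refine ⟨a, fun k hk ↦ ?_⟩
  set ζ₀ := Complex.exp (θ * Complex.I)
  have hζ₀ : ‖ζ₀‖ = 1 := Complex.norm_exp_ofReal_mul_I θ
  set G : ℂ → ℂ := fun z ↦ g z - g ζ₀ - a * (z - ζ₀)
  have hne (z : ℂ) (hz : z ∈ ball (0 : ℂ) 1) : z - ζ₀ ≠ 0 := by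
    rw [sub_ne_zero]
    rintro rfl
    simp [hζ₀] at hz
  have hgc := hgL.continuous
  have hGball : G =o[nhdsWithin ζ₀ (ball 0 1)] (fun z ↦ z - ζ₀) := by
    rw [Asymptotics.isLittleO_iff_tendsto' (by
      filter_upwards [self_mem_nhdsWithin] with z hz h
      exact absurd h (hne z hz))]
    refine tendsto_zero_within_ball_of_tendsto_zero_within_sphere (M := L + ‖a‖) hζ₀
      (((hgd.sub_const _).sub (by fun_prop)).div (by fun_prop) hne)
      (ContinuousOn.div (by fun_prop) (by fun_prop) fun z hz ↦ sub_ne_zero.2 hz.2)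
      (fun z hz ↦ ?_)
      (ha.tendsto_div_nhds_zero.mono_left (nhdsWithin_mono _ sdiff_subset))
    have hpos : 0 < ‖z - ζ₀‖ := norm_pos_iff.2 (sub_ne_zero.2 hz.2)
    rw [norm_div, div_le_iff₀ hpos, add_mul]
    calc ‖G z‖ ≤ ‖g z - g ζ₀‖ + ‖a * (z - ζ₀)‖ := norm_sub_le _ _
      _ ≤ L * ‖z - ζ₀‖ + ‖a‖ * ‖z - ζ₀‖ := by
        rw [norm_mul]
        gcongr
        exact hgL.norm_sub_le z ζ₀
  refine (tendsto_deriv_nontangential_of_isLittleO hζ₀ hk hgd hGball).congr' ?_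
  filter_upwards [self_mem_nhdsWithin] with z hz
  exact (hg' z (mem_ball_zero_iff.2 hz.1)).deriv

/-- The ray from a boundary point of the unit disc in a direction `ν ∈ (-π/2, π/2)` approaches the
point nontangentially. -/
theorem tendsto_ray_nontangential (θ : ℝ) {ν : ℝ} (hν : ν ∈ Ioo (-(Real.pi / 2)) (Real.pi / 2)) :
    Tendsto (fun t : ℝ ↦
        Complex.exp (θ * Complex.I) - (t : ℂ) * Complex.exp ((θ - ν) * Complex.I))
      (nhdsWithin 0 (Ioi 0))
      (nhdsWithin (Complex.exp (θ * Complex.I)) {z | ‖z‖ < 1 ∧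
        Real.cos ν / 2 * ‖z - Complex.exp (θ * Complex.I)‖ ≤ 1 - ‖z‖}) := by
  have hc : 0 < Real.cos ν := Real.cos_pos_of_mem_Ioo hν
  refine tendsto_nhdsWithin_iff.2 ⟨?_, ?_⟩
  · have : Continuous fun t : ℝ ↦
        Complex.exp (θ * Complex.I) - (t : ℂ) * Complex.exp ((θ - ν) * Complex.I) := by fun_prop
    simpa using (this.tendsto 0).mono_left nhdsWithin_le_nhds
  · filter_upwards [Ioo_mem_nhdsGT hc] with t ht
    obtain ⟨ht0, htc⟩ := ht
    set ζ₀ := Complex.exp (θ * Complex.I) with hζ₀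
    set w := Complex.exp ((θ - ν) * Complex.I) with hw
    have hw1 : ‖w‖ = 1 := by
      rw [hw, ← Complex.ofReal_sub, Complex.norm_exp_ofReal_mul_I]
    have hre : (ζ₀ * (starRingEnd ℂ) (t * w)).re = t * Real.cos ν := by
      have h1 : ζ₀ * (starRingEnd ℂ) (t * w) = t * Complex.exp (ν * Complex.I) := by
        rw [hζ₀, hw, map_mul, Complex.conj_ofReal, ← Complex.exp_conj, mul_left_comm,
          ← Complex.exp_add]
        congr 2
        simp
        ring
      rw [h1, Complex.re_ofReal_mul, Complex.exp_ofReal_mul_I_re]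
    have hsq : ‖ζ₀ - t * w‖ ^ 2 = 1 + t ^ 2 - 2 * (t * Real.cos ν) := by
      rw [Complex.sq_norm, Complex.normSq_sub, hre, ← Complex.sq_norm, ← Complex.sq_norm, norm_mul,
        hw1, Complex.norm_exp_ofReal_mul_I, Complex.norm_real, Real.norm_eq_abs, mul_one, sq_abs]
      ring
    have hd : ‖ζ₀ - t * w - ζ₀‖ = t := by
      rw [sub_sub_cancel_left, norm_neg, norm_mul, hw1, Complex.norm_real, Real.norm_eq_abs,
        abs_of_pos ht0, mul_one]
    have h0 := norm_nonneg (ζ₀ - t * w)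
    have htc' : 0 < t * Real.cos ν := mul_pos ht0 hc
    have hle : ‖ζ₀ - t * w‖ ≤ 1 - Real.cos ν / 2 * t := by
      have hcos := Real.cos_le_one ν
      refine abs_le_of_sq_le_sq' ?_ (by nlinarith) |>.2
      nlinarith
    refine ⟨by nlinarith, ?_⟩
    rw [hd]
    linarith

/-- Directional boundary values: for a bounded holomorphic map on the unit disc with
values in a nonzero finite-dimensional complex normed space, and any two directions
`ν, ν' ∈ (-π/2, π/2)`, for almost every `θ ∈ [0, 2π]` the limits of
`u(e^{iθ} - t e^{i(θ-ν)})` and `u(e^{iθ} - t e^{i(θ-ν')})` as `t → 0⁺` exist and agree. -/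
theorem directional_boundary_values_ae_eq
    {E : Type*} [NormedAddCommGroup E] [NormedSpace ℂ E] [FiniteDimensional ℂ E]
    [Nontrivial E]
    (u : ℂ → E) (hu : DifferentiableOn ℂ u (ball (0 : ℂ) 1))
    (hb : Bornology.IsBounded (u '' ball (0 : ℂ) 1))
    (ν ν' : ℝ) (hν : ν ∈ Ioo (-(Real.pi / 2)) (Real.pi / 2))
    (hν' : ν' ∈ Ioo (-(Real.pi / 2)) (Real.pi / 2)) :
    ∀ᵐ (θ : ℝ) ∂(volume.restrict (Icc (0 : ℝ) (2 * Real.pi))),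
      ∃ L : E,
        Tendsto (fun t : ℝ =>
            u (Complex.exp (θ * Complex.I) - (t : ℂ) * Complex.exp ((θ - ν) * Complex.I)))
          (nhdsWithin 0 (Ioi 0)) (nhds L) ∧
        Tendsto (fun t : ℝ =>
            u (Complex.exp (θ * Complex.I) - (t : ℂ) * Complex.exp ((θ - ν') * Complex.I)))
          (nhdsWithin 0 (Ioi 0)) (nhds L) := by
  refine ae_restrict_of_ae ?_
  let e : E ≃L[ℂ] (Fin (Module.finrank ℂ E) → ℂ) :=
    ContinuousLinearEquiv.ofFinrankEq (by simp)
  obtain ⟨B, hB⟩ := hb.exists_norm_le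
  let p (i : Fin (Module.finrank ℂ E)) : E →L[ℂ] ℂ :=
    (ContinuousLinearMap.proj (R := ℂ) (φ := fun _ ↦ ℂ) i).comp (e : E →L[ℂ] _)
  have hcoord (i : Fin (Module.finrank ℂ E)) :=
    ae_exists_tendsto_nontangential (f := fun z ↦ p i (u z)) (M := ‖p i‖₊ * B.toNNReal)
      ((p i).differentiable.comp_differentiableOn hu) fun z hz ↦ by
        refine ((p i).le_opNNNorm (u z)).trans ?_
        gcongr
        exact NNReal.le_toNNReal_of_coe_le (hB _ (mem_image_of_mem u hz))
  filter_upwards [ae_all_iff.2 hcoord] with θ hθ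
  choose a ha using hθ
  have hray {μ : ℝ} (hμ : μ ∈ Ioo (-(Real.pi / 2)) (Real.pi / 2)) :
      Tendsto (fun t : ℝ ↦
          u (Complex.exp (θ * Complex.I) - (t : ℂ) * Complex.exp ((θ - μ) * Complex.I)))
        (nhdsWithin 0 (Ioi 0)) (nhds (e.symm a)) := by
    have hpi := tendsto_pi_nhds.2 fun i ↦
      (ha i _ (half_pos (Real.cos_pos_of_mem_Ioo hμ))).comp (tendsto_ray_nontangential θ hμ)
    simpa [Function.comp_def, p] using (e.symm.continuous.tendsto a).comp hpi
  exact ⟨e.symm a, hray hν, hray hν'⟩
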